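/- arXiv:math/0402301 — 2 statements merged into one kernel-verified Lean document; each statement's English description precedes it below -/
import Mathlib

section
/- Let L be an algebraically closed field, R a finitely generated L-algebra that is an integral domain and is the coordinate ring of a smooth irreducible affine variety over L (i.e., the localization R_𝔪 is a regular local ring for every maximal ideal 𝔪 of R). Let S be an integral domain containing R that is finite as an R-module (so Frac(S) is a finite extension of Frac(R)). Let 𝔪_b be a maximal ideal of S and 𝔪_a = 𝔪_b ∩ R. Then for every valuation subring O of Frac(R) that contains L and dominates the local ring R_{𝔪_a}, there exists a valuation subring O' of Frac(S) that dominates S_{𝔪_b} and satisfies O' ∩ Frac(R) = O. -/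
/-- A local ring is regular if its maximal ideal can be generated by
(Krull dimension)-many elements. -/
def IsRegularLocal (R : Type*) [CommRing R] [IsLocalRing R] : Prop :=
  ∃ s : Finset R, Ideal.span (s : Set R) = IsLocalRing.maximalIdeal R ∧
    (s.card : WithBot ℕ∞) = ringKrullDim R

/-- A Noetherian integrally closed domain is completely integrally closed. -/
lemma dvd_of_forall_pow_dvd_mul_pow {A : Type*} [CommRing A] [IsDomain A] [IsNoetherianRing A]
    [IsIntegrallyClosed A] {a b d : A} (hb : b ≠ 0) (hd : d ≠ 0)
    (h : ∀ n, b ^ n ∣ d * a ^ n) : b ∣ a := by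
  let F := FractionRing A
  have hb' : algebraMap A F b ≠ 0 := by simpa using hb
  have hint : IsAlmostIntegral A (algebraMap A F a / algebraMap A F b) := by
    refine ⟨d, mem_nonZeroDivisors_of_ne_zero hd, fun n ↦ ?_⟩
    obtain ⟨c, hc⟩ := h n
    refine ⟨c, ?_⟩
    rw [Algebra.smul_def, div_pow, mul_div_assoc', eq_div_iff (pow_ne_zero n hb'), ← map_pow,
      ← map_pow, ← map_mul, ← map_mul, hc, mul_comm]
  obtain ⟨c, hc⟩ := IsIntegrallyClosed.isIntegral_iff.mp hint.isIntegral
  rw [eq_div_iff hb', ← map_mul] at hc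
  exact ⟨c, (IsFractionRing.injective A F hc).symm.trans (mul_comm c b)⟩

lemma IsIntegrallyClosed.of_forall_pow_dvd_mul_pow {A : Type*} [CommRing A] [IsDomain A]
    (h : ∀ a b d : A, b ≠ 0 → d ≠ 0 → (∀ n, b ^ n ∣ d * a ^ n) → b ∣ a) :
    IsIntegrallyClosed A := by
  let F := FractionRing A
  refine (isIntegrallyClosed_iff F).mpr fun {y} hy ↦ ?_
  obtain ⟨d, hd, hdy⟩ := hy.isAlmostIntegral
  obtain ⟨a, b, hb, rfl⟩ := IsFractionRing.div_surjective (A := A) y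
  have hb0 : b ≠ 0 := nonZeroDivisors.ne_zero hb
  have hb' : algebraMap A F b ≠ 0 := by simpa using hb0
  obtain ⟨c, rfl⟩ := h a b d hb0 (nonZeroDivisors.ne_zero hd) fun n ↦ by
    obtain ⟨c, hc⟩ := hdy n
    rw [Algebra.smul_def, div_pow, mul_div_assoc', eq_div_iff (pow_ne_zero n hb'), ← map_pow,
      ← map_pow, ← map_mul, ← map_mul] at hc
    exact ⟨c, (IsFractionRing.injective A F hc).symm.trans (mul_comm c _)⟩
  exact ⟨c, by rw [map_mul, mul_div_cancel_left₀ _ hb']⟩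

/-- If `x` lies in the maximal ideal of a Noetherian local domain `A` and `A / x` is an integrally
closed domain, then `A` is integrally closed. -/
lemma IsIntegrallyClosed.of_quotient_span_singleton {A : Type*} [CommRing A] [IsDomain A]
    [IsNoetherianRing A] [IsLocalRing A] {x : A} (hx : x ∈ IsLocalRing.maximalIdeal A)
    [IsDomain (A ⧸ Ideal.span {x})] [IsIntegrallyClosed (A ⧸ Ideal.span {x})] (hx0 : x ≠ 0) :
    IsIntegrallyClosed A := by
  have hxp : Prime x := (Ideal.span_singleton_prime hx0).mp
    ((Ideal.Quotient.isDomain_iff_prime _).mp inferInstance)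
  have hmk (a : A) : Ideal.Quotient.mk (Ideal.span {x}) a = 0 ↔ x ∣ a := by
    rw [Ideal.Quotient.eq_zero_iff_mem, Ideal.mem_span_singleton]
  -- multiples of `x` can be cancelled from `d`
  have hcancel (a b d : A) (hb : ¬ x ∣ b) (hd : d ≠ 0) (h : ∀ n, b ^ n ∣ d * a ^ n) :
      ∃ d', ¬ x ∣ d' ∧ ∀ n, b ^ n ∣ d' * a ^ n := by
    obtain ⟨k, d', hd', rfl⟩ := WfDvdMonoid.max_power_factor hd hxp.irreducible
    refine ⟨d', hd', fun n ↦ ?_⟩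
    obtain ⟨f, hf⟩ := h n
    obtain ⟨g, rfl⟩ : x ^ k ∣ f :=
      hxp.pow_dvd_of_dvd_mul_left k (fun h ↦ hb (hxp.dvd_of_dvd_pow h))
        ⟨d' * a ^ n, by rw [← hf, mul_assoc]⟩
    exact ⟨g, mul_left_cancel₀ (pow_ne_zero k hx0) (by linear_combination hf)⟩
  have hcoprime (a b d : A) (hb : ¬ x ∣ b) (hd : d ≠ 0) (h : ∀ n, b ^ n ∣ d * a ^ n) : b ∣ a := by
    obtain ⟨d, hd, h⟩ := hcancel a b d hb hd h
    let T : Set A := {a | ∀ n, b ^ n ∣ d * a ^ n}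
    suffices hT : Ideal.span T ≤ Ideal.span {b} from
      Ideal.mem_span_singleton.mp (hT (Ideal.subset_span h))
    refine Submodule.le_of_le_smul_of_le_jacobson_bot (I := Ideal.span {x})
      (IsNoetherian.noetherian _) ?_ (Ideal.span_le.mpr fun a ha ↦ ?_)
    · rw [IsLocalRing.jacobson_eq_maximalIdeal _ bot_ne_top]
      simpa [Ideal.span_le] using hx
    obtain ⟨c, hc⟩ := dvd_of_forall_pow_dvd_mul_pow
      (a := Ideal.Quotient.mk (Ideal.span {x}) a) (b := Ideal.Quotient.mk (Ideal.span {x}) b)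
      (d := Ideal.Quotient.mk (Ideal.span {x}) d) (by rwa [Ne, hmk]) (by rwa [Ne, hmk])
      (fun n ↦ by simpa using map_dvd (Ideal.Quotient.mk (Ideal.span {x})) (ha n))
    obtain ⟨c, rfl⟩ := Ideal.Quotient.mk_surjective c
    rw [← map_mul, Ideal.Quotient.eq, Ideal.mem_span_singleton] at hc
    obtain ⟨e, he⟩ := hc
    obtain rfl : a = b * c + x * e := by linear_combination he
    refine add_mem (Ideal.mem_sup_left (Ideal.mem_span_singleton.mpr ⟨c, rfl⟩))
      (Ideal.mem_sup_right (Ideal.mul_mem_mul (Ideal.mem_span_singleton_self x)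
        (Ideal.subset_span fun n ↦ ?_)))
    have hdvd : b ^ n ∣ d * (x * e) ^ n := by
      rw [← he, sub_eq_add_neg, add_pow, Finset.mul_sum]
      refine Finset.dvd_sum fun i hi ↦ ?_
      obtain ⟨f, hf⟩ := ha i
      have hn : b ^ n = b ^ i * b ^ (n - i) := by
        rw [← pow_add, Nat.add_sub_cancel' (Nat.lt_succ_iff.mp (Finset.mem_range.mp hi))]
      refine ⟨f * (-c) ^ (n - i) * n.choose i, ?_⟩
      rw [hn, ← mul_neg, mul_pow b]
      linear_combination (b ^ (n - i) * (-c) ^ (n - i) * n.choose i) * hf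
    obtain ⟨f, hf⟩ := hdvd
    obtain ⟨g, rfl⟩ : x ^ n ∣ f :=
      hxp.pow_dvd_of_dvd_mul_left n (fun h ↦ hb (hxp.dvd_of_dvd_pow h))
        ⟨d * e ^ n, by rw [← hf]; ring⟩
    exact ⟨g, mul_left_cancel₀ (pow_ne_zero n hx0) (by linear_combination hf)⟩
  refine .of_forall_pow_dvd_mul_pow fun a b d hb hd h ↦ ?_
  obtain ⟨k, b, hxb, rfl⟩ := WfDvdMonoid.max_power_factor hb hxp.irreducible
  clear hb
  induction k generalizing a with
  | zero => simpa using hcoprime a b d hxb hd (by simpa using h)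
  | succ k ih =>
    obtain ⟨a, rfl⟩ : x ∣ a := by
      by_contra hxa
      obtain ⟨m, hm⟩ := FiniteMultiplicity.of_not_isUnit hxp.not_isUnit hd
      refine hm (hxp.pow_dvd_of_dvd_mul_right (m + 1) (fun h ↦ hxa (hxp.dvd_of_dvd_pow h))
        ((pow_dvd_pow_of_dvd ?_ _).trans (h (m + 1))))
      exact ⟨x ^ k * b, by ring⟩
    rw [pow_succ', mul_assoc]
    refine mul_dvd_mul_left x (ih a fun n ↦ ?_)
    obtain ⟨f, hf⟩ := h n
    exact ⟨f, mul_left_cancel₀ (pow_ne_zero n hx0) (by linear_combination hf)⟩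

lemma ringKrullDim_le_ringKrullDim_quotient_span_singleton_add_one {A : Type*} [CommRing A]
    [IsLocalRing A] [IsNoetherianRing A] {x : A} (hx : x ∈ IsLocalRing.maximalIdeal A) :
    ringKrullDim A ≤ ringKrullDim (A ⧸ Ideal.span {x}) + 1 := by
  have := ringKrullDim_le_ringKrullDim_quotient_add_card {x}
    (by simpa [IsLocalRing.ringJacobson_eq_maximalIdeal] using hx)
  rwa [Finset.coe_singleton, Finset.card_singleton, Nat.cast_one] at this

/-- A regular local ring is an integrally closed domain. -/
theorem isDomain_and_isIntegrallyClosed_of_span_range_eq_maximalIdeal {n : ℕ} {A : Type*}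
    [CommRing A] [IsLocalRing A] [IsNoetherianRing A] (f : Fin n → A)
    (hf : Ideal.span (Set.range f) = IsLocalRing.maximalIdeal A) (hn : n ≤ ringKrullDim A) :
    IsDomain A ∧ IsIntegrallyClosed A := by
  induction n generalizing A with
  | zero =>
    have hA : IsField A := by
      rw [IsLocalRing.isField_iff_maximalIdeal_eq, ← hf]
      simp
    let := hA.toField
    exact ⟨inferInstance, inferInstance⟩
  | succ n ih =>
    set x := f 0
    have hx : x ∈ IsLocalRing.maximalIdeal A := hf ▸ Ideal.subset_span ⟨0, rfl⟩
    have hxtop : Ideal.span {x} ≠ ⊤ := by rwa [Ne, Ideal.span_singleton_eq_top]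
    have : Nontrivial (A ⧸ Ideal.span {x}) := Ideal.Quotient.nontrivial_iff.mpr hxtop
    let π := Ideal.Quotient.mk (Ideal.span {x})
    have hπ : Function.Surjective π := Ideal.Quotient.mk_surjective
    have : IsLocalRing (A ⧸ Ideal.span {x}) := .of_surjective' π hπ
    have hg : Ideal.span (Set.range fun i : Fin n ↦ π (f i.succ)) =
        IsLocalRing.maximalIdeal (A ⧸ Ideal.span {x}) := by
      have hmap : (IsLocalRing.maximalIdeal A).map π = IsLocalRing.maximalIdeal _ :=
        IsLocalRing.map_maximalIdeal_of_surjective π hπ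
      rw [← hmap, ← hf, Ideal.map_span, ← Set.range_comp, Fin.range_fin_succ, Ideal.span_insert]
      have h0 : (π ∘ f) 0 = 0 := Ideal.Quotient.eq_zero_iff_mem.mpr (Ideal.mem_span_singleton_self x)
      rw [h0, Ideal.span_singleton_zero, bot_sup_eq]
      rfl
    have hdim {p : Ideal A} (hp : p ≠ ⊤) :
        ringKrullDim (A ⧸ p) ≤
          ringKrullDim ((A ⧸ p) ⧸ (Ideal.span {x}).map (Ideal.Quotient.mk p)) + 1 := by
      have : Nontrivial (A ⧸ p) := Ideal.Quotient.nontrivial_iff.mpr hp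
      have : IsLocalRing (A ⧸ p) :=
        .of_surjective' (Ideal.Quotient.mk p) Ideal.Quotient.mk_surjective
      have hmem : Ideal.Quotient.mk p x ∈ IsLocalRing.maximalIdeal (A ⧸ p) := by
        rw [← IsLocalRing.map_maximalIdeal_of_surjective _ Ideal.Quotient.mk_surjective]
        exact Ideal.mem_map_of_mem _ hx
      rw [Ideal.map_span, Set.image_singleton]
      exact ringKrullDim_le_ringKrullDim_quotient_span_singleton_add_one hmem
    have hle : n ≤ ringKrullDim (A ⧸ Ideal.span {x}) := by
      rw [← ENat.WithBot.add_le_add_one_right_iff]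
      exact_mod_cast hn.trans (ringKrullDim_le_ringKrullDim_quotient_span_singleton_add_one hx)
    obtain ⟨_, _⟩ := ih _ hg hle
    have hge : ringKrullDim (A ⧸ Ideal.span {x}) ≤ n := by
      refine (ringKrullDim_le_spanFinrank_maximalIdeal _).trans ?_
      rw [← hg]
      have h1 := Submodule.spanFinrank_span_le_ncard_of_finite (R := A ⧸ Ideal.span {x})
        (Set.finite_range fun i : Fin n ↦ π (f i.succ))
      have h2 : (Set.range fun i : Fin n ↦ π (f i.succ)).ncard ≤ n := by
        rw [← Set.image_univ]
        simpa using Set.ncard_image_le (f := fun i : Fin n ↦ π (f i.succ)) Set.finite_univ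
      exact_mod_cast h1.trans h2
    obtain ⟨p, hp, hpdim⟩ : ∃ p : Ideal A, p.IsPrime ∧ (n + 1 : ℕ) ≤ ringKrullDim (A ⧸ p) := by
      obtain ⟨l, hl⟩ := Order.le_krullDim_iff.mp hn
      refine ⟨l.head.asIdeal, l.head.isPrime, ?_⟩
      rw [ringKrullDim_quotient, Order.le_krullDim_iff]
      exact ⟨⟨l.length, fun i ↦ ⟨l i, l.head_le i⟩, fun i ↦ l.step i⟩, hl⟩
    have hxp : x ∉ p := by
      intro hxp
      have h1 : ringKrullDim (A ⧸ p) ≤ n := (ringKrullDim_le_of_surjective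
        (Ideal.Quotient.factor ((Ideal.span_singleton_le_iff_mem p).mpr hxp))
        (Ideal.Quotient.factor_surjective _)).trans hge
      have := Nat.cast_le.mp (hpdim.trans h1)
      omega
    have hpx : p ≤ Ideal.span {x} := by
      intro y hy
      by_contra hyx
      have hy0 : π y ≠ 0 := fun h ↦ hyx (Ideal.Quotient.eq_zero_iff_mem.mp h)
      have h1 : ringKrullDim ((A ⧸ p) ⧸ (Ideal.span {x}).map (Ideal.Quotient.mk p)) ≤
          ringKrullDim ((A ⧸ Ideal.span {x}) ⧸ Ideal.span {π y}) := by
        rw [ringKrullDim_eq_of_ringEquiv (DoubleQuot.quotQuotEquivComm p (Ideal.span {x}))]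
        exact ringKrullDim_le_of_surjective (Ideal.Quotient.factor
          ((Ideal.span_singleton_le_iff_mem _).mpr (Ideal.mem_map_of_mem _ hy)))
          (Ideal.Quotient.factor_surjective _)
      have h2 := ringKrullDim_quotient_succ_le_of_nonZeroDivisor
        (mem_nonZeroDivisors_of_ne_zero hy0)
      have := Nat.cast_le.mp (hpdim.trans ((hdim hp.ne_top).trans
        ((add_le_add_left h1 1).trans (h2.trans hge))))
      omega
    have hp0 : p = ⊥ := by
      refine Submodule.eq_bot_of_le_smul_of_le_jacobson_bot (Ideal.span {x}) p
        (IsNoetherian.noetherian _) (fun y hy ↦ ?_) ?_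
      · obtain ⟨z, rfl⟩ := Ideal.mem_span_singleton.mp (hpx hy)
        exact Ideal.mul_mem_mul (Ideal.mem_span_singleton_self x)
          ((hp.mem_or_mem hy).resolve_left hxp)
      · rw [IsLocalRing.jacobson_eq_maximalIdeal _ bot_ne_top]
        simpa [Ideal.span_le] using hx
    subst hp0
    have hdom : IsDomain A := IsDomain.of_bot_isPrime A
    exact ⟨hdom, .of_quotient_span_singleton hx (by simpa using hxp)⟩

lemma IsRegularLocal.isIntegrallyClosed {A : Type*} [CommRing A] [IsLocalRing A]
    [IsNoetherianRing A] (h : IsRegularLocal A) : IsIntegrallyClosed A := by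
  obtain ⟨s, hs, hcard⟩ := h
  refine (isDomain_and_isIntegrallyClosed_of_span_range_eq_maximalIdeal
    (fun i ↦ (s.equivFin.symm i : A)) ?_ hcard.le).2
  have : (Set.range fun i ↦ (s.equivFin.symm i : A)) = s := by
    change Set.range (Subtype.val ∘ s.equivFin.symm) = _
    rw [Set.range_comp, s.equivFin.symm.range_eq_univ]
    simp
  rw [this, hs]

/-- If `s` is integral over the integrally closed domain `R` and `s⁻¹` is integral over an
integrally closed overring `V` of `R` with the same fraction field, then the constant coefficient
of the minimal polynomial of `s` over `R` is a unit in `V`. -/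
lemma isUnit_algebraMap_coeff_zero_minpoly {R V K M : Type*} [CommRing R] [IsDomain R]
    [IsIntegrallyClosed R] [CommRing V] [IsDomain V] [IsIntegrallyClosed V] [Field K] [Field M]
    [Algebra R V] [Algebra R K] [Algebra V K] [Algebra R M] [Algebra V M] [Algebra K M]
    [IsFractionRing R K] [IsFractionRing V K] [IsScalarTower R V K] [IsScalarTower R K M]
    [IsScalarTower V K M] [IsScalarTower R V M] {s : M} (hs0 : s ≠ 0) (hs : IsIntegral R s)
    (hinv : IsIntegral V s⁻¹) : IsUnit (algebraMap R V ((minpoly R s).coeff 0)) := by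
  have : FaithfulSMul V M := by
    rw [faithfulSMul_iff_algebraMap_injective, IsScalarTower.algebraMap_eq V K M]
    exact (algebraMap K M).injective.comp (IsFractionRing.injective V K)
  have hsV : IsIntegral V s := hs.tower_top
  have hcoeff : algebraMap R V ((minpoly R s).coeff 0) = (minpoly V s).coeff 0 := by
    apply IsFractionRing.injective V K
    rw [← IsScalarTower.algebraMap_apply, ← Polynomial.coeff_map, ← Polynomial.coeff_map,
      ← minpoly.isIntegrallyClosed_eq_field_fractions' K hs,
      ← minpoly.isIntegrallyClosed_eq_field_fractions' K hsV]
  obtain ⟨q, hq, hqs⟩ := hinv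
  have hroot : Polynomial.aeval s q.reverse = 0 := by
    let := invertibleOfNonzero (inv_ne_zero hs0)
    have := (Polynomial.eval₂_reverse_eq_zero_iff (algebraMap V M) s⁻¹ q).mpr hqs
    simpa [Polynomial.aeval_def] using this
  obtain ⟨g, hg⟩ := minpoly.isIntegrallyClosed_dvd hsV hroot
  rw [hcoeff]
  refine .of_mul_eq_one (g.coeff 0) ?_
  rw [← Polynomial.mul_coeff_zero, ← hg, Polynomial.coeff_zero_reverse, hq.leadingCoeff]

/-- In a finite `R`-algebra, a maximal ideal `Q` contains an element lying in no other prime over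
`p`. -/
lemma Ideal.exists_mem_forall_primesOver_notMem {R S : Type*} [CommRing R] [CommRing S]
    [Algebra R S] [Module.Finite R S] (p : Ideal R) (Q : Ideal S) [hQ : Q.IsMaximal] :
    ∃ s ∈ Q, ∀ P ∈ p.primesOver S, s ∈ P → P = Q := by
  classical
  have hfin := Algebra.QuasiFinite.finite_primesOver (S := S) p
  by_contra! h
  have hsub : (Q : Set S) ⊆ ⋃ P ∈ ((hfin.toFinset.erase Q : Finset (Ideal S)) : Set (Ideal S)),
      (id P : Ideal S) := fun s hs ↦ by
    obtain ⟨P, hP, hsP, hne⟩ := h s hs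
    simp only [Set.mem_iUnion]
    exact ⟨P, by simp [hP, hne], hsP⟩
  obtain ⟨P, hP, hle⟩ := (Ideal.subset_union_prime Q Q fun P hP _ _ ↦ by
    simp only [Finset.mem_erase, Set.Finite.mem_toFinset] at hP
    exact hP.2.1).mp hsub
  simp only [Finset.mem_erase, Set.Finite.mem_toFinset] at hP
  exact hP.1 (hQ.eq_of_le hP.2.1.ne_top hle).symm

/-- A valuation subring `O` of `K` extends to any field extension `M` so that a given element `s`,
integral over `O` but not invertible in the integral closure of `O`, becomes a nonunit. -/
lemma ValuationSubring.exists_comap_eq_of_not_isIntegral_inv {K M : Type*} [Field K] [Field M]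
    [Algebra K M] (O : ValuationSubring K) [Algebra O M] [IsScalarTower O K M] {s : M}
    (hs : IsIntegral O s) (hinv : s ≠ 0 → ¬ IsIntegral O s⁻¹) :
    ∃ W : ValuationSubring M, W.comap (algebraMap K M) = O ∧ s ∈ W.nonunits ∧
      ∀ t, IsIntegral O t → t ∈ W := by
  let B := integralClosure O M
  have hsB : Ideal.span {(⟨s, hs⟩ : B)} ≠ ⊤ := by
    rw [Ne, Ideal.span_singleton_eq_top]
    intro h
    obtain ⟨t, ht⟩ := h.exists_right_inv
    have ht' : s * t = 1 := congrArg Subtype.val ht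
    exact hinv (left_ne_zero_of_mul_eq_one ht') (inv_eq_of_mul_eq_one_right ht' ▸ t.2)
  obtain ⟨n, hn, hle⟩ := Ideal.exists_le_maximal _ hsB
  obtain ⟨W, hBW, hnW⟩ :=
    Ideal.image_subset_nonunits_valuationSubring (A := B.toSubring) n hn.ne_top
  have hOn : n.comap (algebraMap O B) = IsLocalRing.maximalIdeal O :=
    IsLocalRing.eq_maximalIdeal (Ideal.isMaximal_comap_of_isIntegral_of_isMaximal n)
  refine ⟨W, le_antisymm (fun x hx ↦ ?_) fun x hx ↦ ?_,
    hnW ⟨_, hle (Ideal.mem_span_singleton_self _), rfl⟩, fun t ht ↦ hBW ht⟩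
  · by_contra hxO
    obtain ⟨hxinv, hmem⟩ := O.mem_nonunits_iff_exists_mem_maximalIdeal.mp
      (O.inv_mem_nonunits_iff.mpr (Or.inr hxO))
    rw [← hOn] at hmem
    have hmap : (algebraMap K M x)⁻¹ ∈ W.nonunits := by
      rw [← map_inv₀]
      exact hnW ⟨_, hmem, (IsScalarTower.algebraMap_apply O K M ⟨x⁻¹, hxinv⟩)⟩
    rcases W.inv_mem_nonunits_iff.mp hmap with h | h
    · exact hxO ((map_eq_zero _).mp h ▸ O.zero_mem)
    · exact h hx
  · have : IsIntegral O (algebraMap O M ⟨x, hx⟩) := isIntegral_algebraMap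
    rw [IsScalarTower.algebraMap_apply O K M] at this
    exact hBW this

/-- **Lifting of specialisations through finite covers of a smooth base.**
Let `L` be algebraically closed, `R` a finitely generated `L`-algebra domain that is the
coordinate ring of a smooth affine variety (all localizations at maximal ideals are
regular local rings), `S ⊇ R` a domain finite as an `R`-module, `𝔪_b` a maximal ideal of
`S` with `𝔪_a = 𝔪_b ∩ R`, `K = Frac R`, `M = Frac S`.  Then every valuation subring `O`
of `K` containing `L` and dominating `R_{𝔪_a}` lifts to a valuation subring `O'` of `M`
dominating `S_{𝔪_b}` with `O' ∩ K = O`. -/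
theorem stmt_0 (L R S K M : Type*)
    [Field L] [IsAlgClosed L]
    [CommRing R] [IsDomain R] [Algebra L R] [Algebra.FiniteType L R]
    [CommRing S] [IsDomain S] [Algebra R S] [Module.Finite R S]
    (hRS : Function.Injective (algebraMap R S))
    [Field K] [Algebra R K] [IsFractionRing R K]
    [Field M] [Algebra S M] [IsFractionRing S M]
    [Algebra L K] [Algebra R M] [Algebra K M]
    [IsScalarTower L R K] [IsScalarTower R K M] [IsScalarTower R S M]
    (hreg : ∀ (𝔪 : Ideal R) [𝔪.IsMaximal], IsRegularLocal (Localization.AtPrime 𝔪))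
    (𝔪b : Ideal S) [𝔪b.IsMaximal]
    (𝔪a : Ideal R) (h𝔪a : 𝔪a = 𝔪b.comap (algebraMap R S))
    (O : ValuationSubring K)
    (hLO : ∀ l : L, algebraMap L K l ∈ O)
    (hRO : ∀ r : R, algebraMap R K r ∈ O)
    (hdom : (IsLocalRing.maximalIdeal O).comap
      ((algebraMap R K).codRestrict O.toSubring hRO) = 𝔪a) :
    ∃ (O' : ValuationSubring M) (hSO' : ∀ s : S, algebraMap S M s ∈ O'),
      (IsLocalRing.maximalIdeal O').comap
          ((algebraMap S M).codRestrict O'.toSubring hSO') = 𝔪b ∧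
        O'.comap (algebraMap K M) = O := by
  have : IsNoetherianRing R := Algebra.FiniteType.isNoetherianRing L R
  have : IsIntegrallyClosed R := .of_localization_maximal fun 𝔪 _ _ ↦ (hreg 𝔪).isIntegrallyClosed
  let : Algebra R O := ((algebraMap R K).codRestrict O.toSubring hRO).toAlgebra
  let : Algebra O M := ((algebraMap K M).comp (algebraMap O K)).toAlgebra
  have : IsScalarTower O K M := .of_algebraMap_eq fun _ ↦ rfl
  have : IsScalarTower R O K := .of_algebraMap_eq fun _ ↦ rfl
  have : IsScalarTower R O M := .of_algebraMap_eq fun r ↦ IsScalarTower.algebraMap_apply R K M r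
  have h𝔪amax : 𝔪a.IsMaximal := h𝔪a ▸ Ideal.isMaximal_comap_of_isIntegral_of_isMaximal 𝔪b
  have hint (t : S) : IsIntegral R (algebraMap S M t) :=
    (Algebra.IsIntegral.isIntegral t).algebraMap
  obtain ⟨s, hs𝔪b, hs⟩ := 𝔪a.exists_mem_forall_primesOver_notMem 𝔪b
  have hinv (hs0 : algebraMap S M s ≠ 0) : ¬ IsIntegral O (algebraMap S M s)⁻¹ := fun h ↦ by
    have hunit := isUnit_algebraMap_coeff_zero_minpoly (K := K) hs0 (hint s) h
    rw [minpoly.algebraMap_eq (IsFractionRing.injective S M)] at hunit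
    have hmem : (minpoly R s).coeff 0 ∈ 𝔪a :=
      h𝔪a ▸ Ideal.coeff_zero_mem_comap_of_root_mem hs𝔪b (minpoly.aeval R s)
    rw [← hdom] at hmem
    exact hmem hunit
  obtain ⟨W, hWO, hsW, hW⟩ :=
    O.exists_comap_eq_of_not_isIntegral_inv (hint s).tower_top hinv
  have hSW (t : S) : algebraMap S M t ∈ W := hW _ (hint t).tower_top
  refine ⟨W, hSW, hs _ ⟨Ideal.comap_isPrime _ _, ⟨h𝔪amax.eq_of_le ?_ fun r hr ↦ ?_⟩⟩ ?_, hWO⟩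
  · exact (Ideal.IsPrime.comap _).ne_top
  · rw [← hdom] at hr
    have hrO : algebraMap R K r ∈ O.nonunits := O.coe_mem_nonunits_iff.mpr hr
    refine W.coe_mem_nonunits_iff.mp (?_ : algebraMap S M (algebraMap R S r) ∈ W.nonunits)
    rw [← IsScalarTower.algebraMap_apply, IsScalarTower.algebraMap_apply R K M,
      W.mem_nonunits_iff_or, ← map_inv₀, map_eq_zero]
    rw [O.mem_nonunits_iff_or, ← hWO] at hrO
    exact hrO
  · exact W.coe_mem_nonunits_iff.mp hsW
end

section
/- Let φ: R → S be a local homomorphism of Noetherian local rings such that R is a regular local ring, S is a Cohen–Macaulay local ring, and dim S = dim R + dim(S/𝔪_R S), where 𝔪_R is the maximal ideal of R and dimensions are Krull dimensions. Then S is flat as an R-module. -/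
/-- A Noetherian local ring is Cohen–Macaulay if its depth equals its Krull dimension,
i.e. there is a regular sequence contained in the maximal ideal whose length is the
Krull dimension. -/
def IsCohenMacaulayLocal (S : Type*) [CommRing S] [IsLocalRing S] : Prop :=
  ∃ rs : List S, (∀ r ∈ rs, r ∈ IsLocalRing.maximalIdeal S) ∧
    RingTheory.Sequence.IsRegular S rs ∧
    (rs.length : WithBot ℕ∞) = ringKrullDim S

section Flat

open TensorProduct

/-- If the base change of `S` to `R'` is flat, then tensoring with `S` over `R` preserves injectivity
of `R'`-linear maps. -/
theorem LinearMap.rTensor_restrictScalars_injective_of_flat {R R' S A B : Type*}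
    [CommRing R] [CommRing R'] [AddCommGroup S] [Algebra R R'] [Module R S] [AddCommGroup A]
    [AddCommGroup B] [Module R A] [Module R' A] [IsScalarTower R R' A] [Module R B] [Module R' B]
    [IsScalarTower R R' B] [Module.Flat R' (R' ⊗[R] S)] (f : A →ₗ[R'] B)
    (hf : Function.Injective f) :
    Function.Injective ((f.restrictScalars R).rTensor S) := by
  have h := Module.Flat.rTensor_preserves_injective_linearMap (M := R' ⊗[R] S) f hf
  let eA := AlgebraTensorModule.cancelBaseChange R R' R' A S
  let eB := AlgebraTensorModule.cancelBaseChange R R' R' B S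
  have key : ∀ t, (f.restrictScalars R).rTensor S t = eB (f.rTensor (R' ⊗[R] S) (eA.symm t)) := by
    intro t
    induction t with
    | zero => simp
    | add a b ha hb => rw [map_add, ha, hb, map_add, map_add, map_add]
    | tmul a s => simp [eA, eB]
  intro a b hab
  rw [key, key] at hab
  exact eA.symm.injective (h (eB.injective hab))

/-- If `x` is `S`-regular with image in the Jacobson radical of `S`, and `S ⧸ xS` is flat over
`R ⧸ xR`, then `S` is flat over `R`. No regularity of `x` on `R` is required. -/
theorem Module.Flat.of_flat_quotient_span_singleton {R S : Type*} [CommRing R] [CommRing S]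
    [Algebra R S] [IsNoetherianRing R] [IsNoetherianRing S]
    {x : R} (hxS : algebraMap R S x ∈ Ring.jacobson S) (hreg : IsSMulRegular S x)
    (hflat : Module.Flat (R ⧸ Ideal.span {x})
      (S ⧸ (Ideal.span {x}).map (algebraMap R S))) :
    Module.Flat R S := by
  rw [Module.Flat.iff_lTensor_injective']
  intro I
  induction I using IsNoetherian.induction with
  | hgt I ih =>
  have hregR : IsSMulRegular (S ⊗[R] R) x :=
    ((TensorProduct.rid R S).isSMulRegular_congr x).mpr hreg
  have : Module.Flat (R ⧸ Ideal.span {x}) ((R ⧸ Ideal.span {x}) ⊗[R] S) :=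
    .of_linearEquiv
      (Algebra.TensorProduct.quotIdealMapEquivQuotTensor S (Ideal.span {x})).symm.toLinearEquiv
  let J : Ideal R := I.colon {x}
  let q := Ideal.Quotient.mk (Ideal.span {x})
  let μ : J →ₗ[R] I := (x • J.subtype).codRestrict I fun r ↦ by
    simpa [mul_comm] using Submodule.mem_colon_singleton.mp r.2
  let I' := Ideal.map q I
  let g : I →ₗ[R] I' :=
    ((Ideal.Quotient.mkₐ R (Ideal.span {x})).toLinearMap ∘ₗ I.subtype).codRestrict
      (I'.restrictScalars R) fun r ↦ Ideal.mem_map_of_mem q r.2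
  have hg : Function.Surjective g := by
    rintro ⟨y, hy⟩
    obtain ⟨r, hr, rfl⟩ := (Ideal.mem_map_iff_of_surjective q Ideal.Quotient.mk_surjective).mp hy
    exact ⟨⟨r, hr⟩, rfl⟩
  have hex : Function.Exact μ g := by
    rintro ⟨r, hr⟩
    have : g ⟨r, hr⟩ = 0 ↔ q r = 0 := Subtype.ext_iff
    rw [this, Ideal.Quotient.eq_zero_iff_mem, Ideal.mem_span_singleton']
    constructor
    · rintro ⟨a, rfl⟩
      refine ⟨⟨a, by simpa [J, Submodule.mem_colon_singleton] using hr⟩, Subtype.ext ?_⟩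
      simp [μ, mul_comm]
    · rintro ⟨a, ha⟩
      refine ⟨a, ?_⟩
      have := congrArg Subtype.val ha
      simpa [μ, mul_comm] using this
  have hI' : Function.Injective ((I'.subtype.restrictScalars R).lTensor S) := by
    rw [LinearMap.lTensor_inj_iff_rTensor_inj]
    exact LinearMap.rTensor_restrictScalars_injective_of_flat I'.subtype I'.injective_subtype
  have lift (t : S ⊗[R] I) (ht : I.subtype.lTensor S t = 0) :
      ∃ u : S ⊗[R] J, μ.lTensor S u = t ∧ J.subtype.lTensor S u = 0 := by
    have hgt : g.lTensor S t = 0 := by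
      apply hI'
      have hcomp : I'.subtype.restrictScalars R ∘ₗ g =
        (Ideal.Quotient.mkₐ R (Ideal.span {x})).toLinearMap ∘ₗ I.subtype := rfl
      rw [map_zero, ← LinearMap.lTensor_comp_apply, hcomp, LinearMap.lTensor_comp_apply, ht,
        map_zero]
    obtain ⟨u, rfl⟩ := (_root_.lTensor_exact S hex hg t).mp hgt
    refine ⟨u, rfl, hregR.right_eq_zero_of_smul ?_⟩
    have hcomp : I.subtype ∘ₗ μ = x • J.subtype := rfl
    rwa [← LinearMap.lTensor_comp_apply, hcomp, LinearMap.lTensor_smul] at ht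
  have hIJ : I ≤ J := fun r hr ↦
    Submodule.mem_colon_singleton.mpr (Ideal.mul_mem_right x I hr)
  rcases hIJ.lt_or_eq with hlt | heq
  · rw [injective_iff_map_eq_zero]
    intro t ht
    obtain ⟨u, rfl, hu⟩ := lift t ht
    rw [(injective_iff_map_eq_zero _).mp (ih J hlt) u hu, map_zero]
  · let φ : S ⊗[R] I →ₗ[S] S ⊗[R] R := I.subtype.baseChange S
    suffices LinearMap.ker φ = ⊥ from (LinearMap.ker_eq_bot (f := φ)).mp this
    refine (IsNoetherian.noetherian _).eq_bot_of_le_jacobson_smul fun t ht ↦ ?_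
    obtain ⟨u, rfl, hu⟩ := lift t ht
    let ι : J →ₗ[R] I := Submodule.inclusion heq.ge
    have hμ : μ = x • ι := rfl
    rw [hμ, LinearMap.lTensor_smul, LinearMap.smul_apply, ← algebraMap_smul S x]
    refine Submodule.smul_mem_smul hxS ?_
    change I.subtype.lTensor S _ = 0
    rw [← LinearMap.lTensor_comp_apply]
    exact hu

/-- If a maximal ideal of `R` is generated by a weakly `S`-regular sequence whose image lies in the
Jacobson radical of `S`, then `S` is flat over `R`. -/
theorem Module.Flat.of_isWeaklyRegular_of_isMaximal_ofList {R S : Type*} [CommRing R] [CommRing S]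
    [Algebra R S] [IsNoetherianRing R] [IsNoetherianRing S] (xs : List R)
    (hmax : (Ideal.ofList xs).IsMaximal)
    (hjac : ∀ x ∈ xs, algebraMap R S x ∈ Ring.jacobson S)
    (hreg : RingTheory.Sequence.IsWeaklyRegular S xs) : Module.Flat R S := by
  generalize hn : xs.length = n
  induction n generalizing R S with
  | zero =>
    obtain rfl := List.length_eq_zero_iff.mp hn
    rw [Ideal.ofList_nil] at hmax
    have : Nontrivial R :=
      nontrivial_of_ne 0 1 fun h ↦ hmax.ne_top ((Ideal.eq_top_iff_one _).mpr (h ▸ zero_mem _))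
    let := Ring.isField_iff_maximal_bot.mpr hmax |>.toField
    infer_instance
  | succ n ih =>
    obtain _ | ⟨x, xs⟩ := xs
    · simp at hn
    rw [RingTheory.Sequence.isWeaklyRegular_cons_iff] at hreg
    simp only [List.mem_cons, forall_eq_or_imp] at hjac
    refine .of_flat_quotient_span_singleton hjac.1 hreg.1 ?_
    refine ih (xs.map (Ideal.Quotient.mk (Ideal.span {x}))) ?_ ?_ ?_ (by simpa using hn)
    · have hmap : Ideal.ofList (xs.map (Ideal.Quotient.mk (Ideal.span {x}))) =
          (Ideal.ofList (x :: xs)).map (Ideal.Quotient.mk (Ideal.span {x})) := by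
        simp [Ideal.map_sup]
      rw [hmap]
      refine hmax.map_of_surjective_of_ker_le Ideal.Quotient.mk_surjective ?_
      rw [Ideal.mk_ker, Ideal.ofList_cons]
      exact le_sup_left
    · simp only [List.mem_map, forall_exists_index, and_imp, forall_apply_eq_imp_iff₂]
      have : RingHomSurjective (Ideal.Quotient.mk ((Ideal.span {x}).map (algebraMap R S))) :=
        ⟨Ideal.Quotient.mk_surjective⟩
      exact fun y hy ↦ Ring.le_comap_jacobson
        (Ideal.Quotient.mk ((Ideal.span {x}).map (algebraMap R S))) (hjac.2 y hy)
    · rw [← Ideal.Quotient.algebraMap_eq, RingTheory.Sequence.isWeaklyRegular_map_algebraMap_iff]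
      let e : QuotSMulTop x S ≃ₗ[R] S ⧸ (Ideal.span {x}).map (algebraMap R S) :=
        (Submodule.quotEquivOfEq _ _ <| by
          rw [← Submodule.ideal_span_singleton_smul, Ideal.smul_top_eq_map]).trans
        (Submodule.Quotient.restrictScalarsEquiv R ((Ideal.span {x}).map (algebraMap R S)))
      exact (e.isWeaklyRegular_congr xs).mp hreg.2

end Flat

section Regular

open IsLocalRing RingTheory.Sequence CategoryTheory Abelian Pointwise

universe u

variable {S : Type u} [CommRing S] [IsLocalRing S] [IsNoetherianRing S]

/-- The depth of a finite module is at most `dim (S ⧸ p)` for every associated prime `p`. -/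
theorem RingTheory.Sequence.IsWeaklyRegular.length_le_ringKrullDim_quotient
    {M : Type*} [AddCommGroup M] [Module S M] [Module.Finite S M] {rs : List S}
    (hreg : IsWeaklyRegular M rs) (hmem : ∀ r ∈ rs, r ∈ maximalIdeal S)
    {p : Ideal S} (hp : p ∈ associatedPrimes S M) :
    (rs.length : WithBot ℕ∞) ≤ ringKrullDim (S ⧸ p) := by
  induction rs generalizing M p with
  | nil =>
    have := hp.isPrime
    simpa using ringKrullDim_nonneg_of_nontrivial
  | cons a rs ih =>
    rw [isWeaklyRegular_cons_iff] at hreg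
    simp only [List.mem_cons, forall_eq_or_imp] at hmem
    have hpprime : p.IsPrime := hp.isPrime
    obtain ⟨-, z, hz⟩ := isAssociatedPrime_iff.mp hp
    have hzp (r : S) : r ∈ p ↔ r • z = 0 := by
      rw [hz, Submodule.mem_colon_singleton, Submodule.mem_bot]
    have hz0 : z ≠ 0 := fun h ↦ hpprime.one_notMem ((hzp 1).mpr (by simp [h]))
    have hap : a ∉ p := fun h ↦ hz0 (hreg.1.right_eq_zero_of_smul ((hzp a).mp h))
    let N : Submodule S M := Submodule.torsionBySet S M p
    have hN (m : M) : m ∈ N ↔ ∀ r ∈ p, r • m = 0 := by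
      simp [N, Submodule.mem_torsionBySet_iff]
    obtain ⟨w, hwN, hw⟩ : ∃ w ∈ N, w ∉ a • (⊤ : Submodule S M) := by
      by_contra! hcon
      have hNbot : N = ⊥ := by
        refine Submodule.eq_bot_of_le_smul_of_le_jacobson_bot (maximalIdeal S) N
          (IsNoetherian.noetherian N) (fun m hm ↦ ?_) (maximalIdeal_le_jacobson _)
        obtain ⟨m', -, rfl⟩ := hcon m hm
        refine Submodule.smul_mem_smul hmem.1 ((hN _).mpr fun r hr ↦ ?_)
        refine hreg.1.right_eq_zero_of_smul ?_
        rw [smul_comm]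
        exact (hN _).mp hm r hr
      exact hz0 ((Submodule.mem_bot S).mp (hNbot ▸ (hN z).mpr fun r hr ↦ (hzp r).mp hr))
    have hw0 : (Submodule.Quotient.mk w : QuotSMulTop a M) ≠ 0 := by
      rwa [Ne, Submodule.Quotient.mk_eq_zero]
    obtain ⟨q, hq, hqle⟩ := exists_le_isAssociatedPrime_of_isNoetherianRing (R := S) _ hw0
    have hpq : p ≤ q := fun r hr ↦ hqle <| Submodule.mem_colon_singleton.mpr <| by
      rw [← Submodule.Quotient.mk_smul, (hN w).mp hwN r hr]
      simp
    have haq : a ∈ q := hqle <| Submodule.mem_colon_singleton.mpr <| by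
      rw [← Submodule.Quotient.mk_smul, Submodule.mem_bot, Submodule.Quotient.mk_eq_zero]
      exact Submodule.smul_mem_pointwise_smul _ _ _ trivial
    have hdim : ringKrullDim (S ⧸ q) + 1 ≤ ringKrullDim (S ⧸ p) := by
      refine ringKrullDim_succ_le_of_surjective (Ideal.Quotient.factor hpq)
        (Ideal.Quotient.factor_surjective hpq) (r := Ideal.Quotient.mk p a) ?_ ?_
      · exact mem_nonZeroDivisors_of_ne_zero (by rwa [Ne, Ideal.Quotient.eq_zero_iff_mem])
      · simpa [Ideal.Quotient.eq_zero_iff_mem] using haq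
    calc ((a :: rs).length : WithBot ℕ∞) = rs.length + 1 := by simp
      _ ≤ ringKrullDim (S ⧸ q) + 1 := by gcongr; exact ih hreg.2 hmem.2 hq
      _ ≤ _ := hdim

/-- Quotienting by a regular element lowers the depth by at most one. -/
theorem RingTheory.Sequence.IsRegular.exists_isRegular_quotSMulTop
    {M : Type u} [AddCommGroup M] [Module S M] [Module.Finite S M] {rs : List S}
    (hreg : IsRegular M rs) (hmem : ∀ r ∈ rs, r ∈ maximalIdeal S) {x : S}
    (hx : x ∈ maximalIdeal S) (hxreg : IsSMulRegular M x) :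
    ∃ rs' : List S, rs'.length = rs.length - 1 ∧ (∀ r ∈ rs', r ∈ maximalIdeal S) ∧
      IsRegular (QuotSMulTop x M) rs' := by
  have hM := hreg.nontrivial
  have hlt (M : Type u) [AddCommGroup M] [Module S M] [Module.Finite S M] [Nontrivial M] :
      maximalIdeal S • (⊤ : Submodule S M) < ⊤ :=
    (Submodule.top_ne_ideal_smul_of_le_jacobson_annihilator
      (maximalIdeal_le_jacobson _)).symm.lt_top
  have hM' := nontrivial_quotSMulTop_of_mem_maximalIdeal (L := M) hx
  have hext : ∀ i < rs.length, Subsingleton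
      (Ext (ModuleCat.of S (Shrink.{u} (S ⧸ maximalIdeal S))) (ModuleCat.of S M) i) := by
    refine ((ModuleCat.exists_isRegular_tfae (maximalIdeal S) rs.length (.of S M)
      (hlt M)).out 1 3).mpr ?_
    exact ⟨rs, rfl, hmem, hreg⟩
  refine ((ModuleCat.exists_isRegular_tfae (maximalIdeal S) (rs.length - 1)
    (.of S (QuotSMulTop x M)) (hlt _)).out 1 3).mp fun i hi ↦ ?_
  have zero₁ := AddCommGrpCat.isZero_of_iff_subsingleton.mpr (hext i (by omega))
  have zero₂ := AddCommGrpCat.isZero_of_iff_subsingleton.mpr (hext (i + 1) (by omega))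
  have hxreg' : IsSMulRegular (ModuleCat.of S M) x := hxreg
  exact AddCommGrpCat.subsingleton_of_isZero <| ShortComplex.Exact.isZero_of_both_zeros
    (Ext.covariant_sequence_exact₃' _ hxreg'.smulShortComplex_shortExact i (i + 1) rfl)
    (zero₁.eq_zero_of_src _) (zero₂.eq_zero_of_tgt _)

theorem Module.supportDim_le_supportDim_quotient_ofList_add_length
    {M : Type*} [AddCommGroup M] [Module S M] [Module.Finite S M] {xs : List S}
    (hmem : ∀ x ∈ xs, x ∈ maximalIdeal S) :
    supportDim S M ≤ supportDim S (M ⧸ Ideal.ofList xs • (⊤ : Submodule S M)) + xs.length := by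
  induction xs generalizing M with
  | nil =>
    rw [Ideal.ofList_nil, Submodule.bot_smul]
    simpa using (supportDim_eq_of_equiv (Submodule.quotEquivOfEqBot ⊥ rfl)).ge
  | cons x xs ih =>
    simp only [List.mem_cons, forall_eq_or_imp] at hmem
    rw [supportDim_eq_of_equiv (Submodule.quotOfListConsSMulTopEquivQuotSMulTopInner M x _)]
    calc supportDim S M ≤ supportDim S (QuotSMulTop x M) + 1 :=
          supportDim_le_supportDim_quotSMulTop_succ hmem.1
      _ ≤ _ := by
        grw [ih hmem.2]
        simp [add_assoc]

/-- If quotienting `M` by `xs` lowers the dimension from the depth of `M` by at least the length of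
`xs`, then `xs` is weakly regular on `M`. In particular, part of a system of parameters of a
Cohen–Macaulay module is a regular sequence. -/
theorem RingTheory.Sequence.IsRegular.isWeaklyRegular_of_supportDim_add_length_le
    {M : Type u} [AddCommGroup M] [Module S M] [Module.Finite S M] {rs : List S}
    (hreg : IsRegular M rs) (hrs : ∀ r ∈ rs, r ∈ maximalIdeal S) {xs : List S}
    (hxs : ∀ x ∈ xs, x ∈ maximalIdeal S)
    (hdim : Module.supportDim S (M ⧸ Ideal.ofList xs • (⊤ : Submodule S M)) + xs.length ≤
      rs.length) :
    IsWeaklyRegular M xs := by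
  induction xs generalizing M rs with
  | nil => exact .nil S M
  | cons x xs ih =>
    simp only [List.mem_cons, forall_eq_or_imp] at hxs
    have hx : IsSMulRegular M x := by
      by_contra hx
      have hx' : x ∈ ⋃ p ∈ associatedPrimes S M, (p : Set S) := by
        rwa [biUnion_associatedPrimes_eq_compl_regular]
      simp only [Set.mem_iUnion, SetLike.mem_coe] at hx'
      obtain ⟨p, hp, hxp⟩ := hx'
      have hpprime : p.IsPrime := hp.isPrime
      have hle : Module.supportDim S ((S ⧸ p) ⧸ Ideal.ofList xs • (⊤ : Submodule S (S ⧸ p))) ≤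
          Module.supportDim S (M ⧸ Ideal.ofList (x :: xs) • (⊤ : Submodule S M)) := by
        have hsub : Module.support S ((S ⧸ p) ⧸ Ideal.ofList xs • (⊤ : Submodule S (S ⧸ p))) ⊆
            Module.support S (M ⧸ Ideal.ofList (x :: xs) • (⊤ : Submodule S M)) := by
          rw [Module.support_quotient, Module.support_quotient]
          rintro q ⟨hq₁, hq₂⟩
          have hpq : p ≤ q.asIdeal := by
            rw [Module.mem_support_iff_of_finite, Ideal.annihilator_quotient] at hq₁
            exact hq₁
          refine ⟨?_, ?_⟩
          · rw [Module.mem_support_iff_of_finite]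
            simpa [Submodule.annihilator_top] using hp.annihilator_le.trans hpq
          · rw [PrimeSpectrum.mem_zeroLocus, SetLike.coe_subset_coe] at hq₂ ⊢
            rw [Ideal.ofList_cons, sup_le_iff, Ideal.span_singleton_le_iff_mem]
            exact ⟨hpq hxp, hq₂⟩
        exact Order.krullDim_le_of_strictMono (fun a ↦ ⟨a.1, hsub a.2⟩) fun _ _ h ↦ h
      have h₁ := hreg.toIsWeaklyRegular.length_le_ringKrullDim_quotient hrs hp
      have h₂ := Module.supportDim_le_supportDim_quotient_ofList_add_length (M := S ⧸ p) hxs.2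
      rw [Module.supportDim_quotient_eq_ringKrullDim] at h₂
      have h₃ : (rs.length : WithBot ℕ∞) + 1 ≤ rs.length := by
        refine le_trans ?_ hdim
        grw [h₁, h₂, hle]
        simp [add_assoc]
      exact absurd h₃ (by norm_cast; omega)
    obtain ⟨rs', hlen, hrs', hreg'⟩ := hreg.exists_isRegular_quotSMulTop hrs hxs.1 hx
    refine .cons hx (ih hreg' hrs' hxs.2 ?_)
    rw [← Module.supportDim_eq_of_equiv
      (Submodule.quotOfListConsSMulTopEquivQuotSMulTopInner M x xs), hlen]
    generalize Module.supportDim S (M ⧸ Ideal.ofList (x :: xs) • (⊤ : Submodule S M)) = D at hdim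
    induction D with
    | bot => simp
    | coe D =>
      induction D with
      | top => exact absurd hdim (by norm_cast)
      | coe k =>
        rw [List.length_cons] at hdim
        generalize hm : rs.length - 1 = m
        norm_cast at hdim ⊢
        omega

end Regular

/-- **Miracle flatness.** A local homomorphism `R → S` of Noetherian local rings with `R`
regular, `S` Cohen–Macaulay and `dim S = dim R + dim (S/𝔪_R S)` is flat. -/
theorem stmt_2 (R S : Type*) [CommRing R] [CommRing S]
    [IsLocalRing R] [IsLocalRing S]
    [IsNoetherianRing R] [IsNoetherianRing S]
    [Algebra R S] [IsLocalHom (algebraMap R S)]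
    (hreg : IsRegularLocal R)
    (hCM : IsCohenMacaulayLocal S)
    (hdim : ringKrullDim S =
      ringKrullDim R +
        ringKrullDim (S ⧸ Ideal.map (algebraMap R S) (IsLocalRing.maximalIdeal R))) :
    Module.Flat R S := by
  obtain ⟨s, hs, hcard⟩ := hreg
  obtain ⟨rs, hrs, hregular, hlen⟩ := hCM
  have hspan : Ideal.ofList s.toList = IsLocalRing.maximalIdeal R := by
    simp [Ideal.ofList, ← hs]
  have hmem : ∀ x ∈ s.toList, algebraMap R S x ∈ IsLocalRing.maximalIdeal S := fun x hx ↦ by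
    have hx' : x ∈ IsLocalRing.maximalIdeal R := hspan ▸ Ideal.subset_span hx
    exact map_nonunit (algebraMap R S) x hx'
  refine .of_isWeaklyRegular_of_isMaximal_ofList s.toList
    (hspan ▸ IsLocalRing.maximalIdeal.isMaximal R)
    (by rwa [IsLocalRing.ringJacobson_eq_maximalIdeal]) ?_
  rw [← RingTheory.Sequence.isWeaklyRegular_map_algebraMap_iff S]
  refine hregular.isWeaklyRegular_of_supportDim_add_length_le hrs (by simpa using hmem) ?_
  rw [← Ideal.map_ofList, hspan, smul_eq_mul, Ideal.mul_top,
    Module.supportDim_quotient_eq_ringKrullDim, List.length_map, Finset.length_toList, hcard,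
    hlen, hdim, add_comm]
end
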